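/- Gibbs–Bogoliubov-type lower bound on the Nishimori line via a random-field trial system: for the Kac-potential spin glass with couplings J^{(γ)}_{ij} ~ N(√(x^{(γ)}_{ij}), 1) and any q ≥ 0, E[log Z_L^{(γ)}] ≥ E[log Z_L^{RF}] + (1/2) Σ_{i≠j} x^{(γ)}_{ij} (1 + ⟨σ_iσ_j⟩_{RF} average identities) − (1/2) Σ_i x_i (1 + E[⟨σ_i⟩_{RF}]), where Z_L^{RF} is the partition function of the random field model with fields h_i ~ N(√(x_i), 1), x_i = β²q, evaluated with x^{(γ)}_{ij} = β² K(r_{ij},γ)/2. Explicitly, E[log Z_L^{(γ)}] ≥ L^d ∫ Dy log 2cosh(β√q y + β²q) + (1/2) Σ_{i≠j} x^{(γ)}_{ij} (1 + (∫ Dy tanh(β√q y + β²q))²) − (L^d β² q/2)(1 + ∫ Dy tanh(β√q y + β²q)). -/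

import Mathlib

open MeasureTheory ProbabilityTheory

/-- The Ising spin value of a configuration at a site. -/
noncomputable def spin {N : ℕ} (σ : Fin N → Bool) (i : Fin N) : ℝ :=
  if σ i then 1 else -1


lemma gauss_shift (m : ℝ) : gaussianReal m 1 = (gaussianReal 0 1).withDensity
    (fun x => ENNReal.ofReal (Real.exp (m * x - m ^ 2 / 2))) := by
  rw [gaussianReal_of_var_ne_zero _ one_ne_zero, gaussianReal_of_var_ne_zero _ one_ne_zero,
    ← withDensity_mul _ (by fun_prop) (by fun_prop)]
  congr 1
  ext x
  simp only [gaussianPDF, Pi.mul_apply]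
  rw [← ENNReal.ofReal_mul (gaussianPDFReal_nonneg _ _ _)]
  congr 1
  simp only [gaussianPDFReal]
  rw [mul_assoc _ (Real.exp _), ← Real.exp_add]
  congr 2
  simp
  ring

lemma pi_dens {A : Type*} [Fintype A] (f : A → ℝ → ENNReal) (hf : ∀ a, Measurable (f a))
    (μ : A → Measure ℝ) [∀ a, IsProbabilityMeasure (μ a)]
    (ν : A → Measure ℝ) [∀ a, IsProbabilityMeasure (ν a)]
    (h : ∀ a, ν a = (μ a).withDensity (f a)) :
    Measure.pi ν = (Measure.pi μ).withDensity (fun x => ∏ a, f a (x a)) := by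
  refine Measure.pi_eq fun s hs => ?_
  rw [withDensity_apply _ (MeasurableSet.univ_pi hs), ← lintegral_indicator (MeasurableSet.univ_pi hs)]
  have h1 : ∀ x : A → ℝ, (Set.univ.pi s).indicator (fun x => ∏ a, f a (x a)) x
      = ∏ a, (s a).indicator (f a) (x a) := by
    intro x
    by_cases hx : x ∈ Set.univ.pi s
    · rw [Set.indicator_of_mem hx]
      refine Finset.prod_congr rfl fun a _ => ?_
      rw [Set.indicator_of_mem (hx a trivial)]
    · rw [Set.indicator_of_notMem hx]
      simp only [Set.mem_pi, not_forall] at hx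
      obtain ⟨a, _, ha⟩ := hx
      symm
      refine Finset.prod_eq_zero (Finset.mem_univ a) (Set.indicator_of_notMem ha _)
  simp_rw [h1]
  have hm : ∀ a, Measurable ((s a).indicator (f a)) := fun a => (hf a).indicator (hs a)
  have := lintegral_prod_eq_prod_lintegral_of_indepFun (μ := Measure.pi μ) Finset.univ
    (fun a (x : A → ℝ) => (s a).indicator (f a) (x a))
    (iIndepFun_pi (fun a => (hm a).aemeasurable)) (fun a => (hm a).comp (measurable_pi_apply a))
  rw [this]
  refine Finset.prod_congr rfl fun a _ => ?_
  rw [h a, withDensity_apply _ (hs a), ← lintegral_indicator (hs a)]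
  exact (measurePreserving_eval μ a).lintegral_comp (hm a)

lemma stein1 (f f' : ℝ → ℝ) (hf : ∀ r, HasDerivAt f (f' r) r) (hf'c : Continuous f') (B : ℝ)
    (hB : ∀ r, |f r| ≤ B) (hB' : ∀ r, |f' r| ≤ B) :
    ∫ r, r * f r ∂(gaussianReal 0 1) = ∫ r, f' r ∂(gaussianReal 0 1) := by
  have hfc : Continuous f := continuous_iff_continuousAt.2 fun r => (hf r).continuousAt
  have hid : Integrable (fun r : ℝ => r) (gaussianReal 0 1) :=
    (memLp_id_gaussianReal 1).integrable (by simp)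
  have i1 : Integrable (fun r => r * f r) (gaussianReal 0 1) :=
    hid.mul_bdd (c := B) hfc.aestronglyMeasurable (by simpa using Filter.Eventually.of_forall hB)
  have i2 : Integrable f' (gaussianReal 0 1) :=
    Integrable.of_bound hf'c.aestronglyMeasurable B (by simpa using Filter.Eventually.of_forall hB')
  have i3 : Integrable f (gaussianReal 0 1) :=
    Integrable.of_bound hfc.aestronglyMeasurable B (by simpa using Filter.Eventually.of_forall hB)
  have key : ∀ g : ℝ → ℝ, Integrable g (gaussianReal 0 1) →
      Integrable (fun x => g x * gaussianPDFReal 0 1 x) := by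
    intro g hg
    rw [gaussianReal_of_var_ne_zero _ one_ne_zero,
      integrable_withDensity_iff_integrable_smul' (by fun_prop) (by simp [gaussianPDF])] at hg
    refine hg.congr (Filter.Eventually.of_forall fun x => ?_)
    simp [gaussianPDF, gaussianPDFReal_nonneg, mul_comm]
  rw [integral_gaussianReal_eq_integral_smul one_ne_zero,
    integral_gaussianReal_eq_integral_smul one_ne_zero]
  have hd : ∀ x, HasDerivAt (gaussianPDFReal 0 1) (-x * gaussianPDFReal 0 1 x) x := by
    intro x
    have h1 : HasDerivAt (fun x : ℝ => - (x - 0) ^ 2 / (2 * ((1 : NNReal) : ℝ))) (-x) x := by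
      have := (((hasDerivAt_id x).sub_const 0).pow 2).neg.div_const (2 * ((1 : NNReal) : ℝ))
      convert! this using 1
      simp
      ring
    have := h1.exp.const_mul (√(2 * Real.pi * ((1 : NNReal) : ℝ)))⁻¹
    unfold gaussianPDFReal
    convert! this using 1
    ring
  have := integral_mul_deriv_eq_deriv_mul_of_integrable (u := f) (v := gaussianPDFReal 0 1)
    (u' := f') (v' := fun x => -x * gaussianPDFReal 0 1 x) (fun x _ => hf x) (fun x _ => hd x)
    (by
      refine (key _ i1).neg.congr (Filter.Eventually.of_forall fun x => ?_)
      simp; ring) (key _ i2) (key _ i3)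
  have e : ∫ x, gaussianPDFReal 0 1 x • (x * f x) = - ∫ x, f x * (-x * gaussianPDFReal 0 1 x) := by
    rw [← integral_neg]; congr 1; ext x; simp; ring
  rw [e, this, neg_neg]
  congr 1; ext x; simp; ring

lemma pi_update {A : Type*} [Fintype A] [DecidableEq A] (μ : A → Measure ℝ)
    [∀ a, IsProbabilityMeasure (μ a)] (a : A) :
    MeasurePreserving (fun p : (A → ℝ) × ℝ => Function.update p.1 a p.2)
      ((Measure.pi μ).prod (μ a)) (Measure.pi μ) := by
  have hm : Measurable (fun p : (A → ℝ) × ℝ => Function.update p.1 a p.2) := by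
    rw [measurable_pi_iff]
    intro b
    by_cases hb : b = a
    · subst hb; simp; fun_prop
    · simp [Function.update_of_ne hb]; fun_prop
  refine ⟨hm, ?_⟩
  symm
  refine Measure.pi_eq fun s hs => ?_
  rw [Measure.map_apply hm (MeasurableSet.univ_pi hs)]
  have : (fun p : (A → ℝ) × ℝ => Function.update p.1 a p.2) ⁻¹' (Set.univ.pi s)
      = (Set.univ.pi (Function.update s a Set.univ)) ×ˢ (s a) := by
    ext p
    simp only [Set.mem_preimage, Set.mem_pi, Set.mem_univ, true_imp_iff, Set.mem_prod]
    constructor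
    · intro h
      refine ⟨fun b => ?_, by simpa using h a⟩
      by_cases hb : b = a
      · subst hb; simp
      · simpa [Function.update_of_ne hb] using h b
    · rintro ⟨h, h'⟩ b
      by_cases hb : b = a
      · subst hb; simpa using h'
      · simpa [Function.update_of_ne hb] using h b
  rw [this, Measure.prod_prod, Measure.pi_pi, ← Finset.prod_erase_mul _ _ (Finset.mem_univ a),
    ← Finset.prod_erase_mul Finset.univ (fun i => (μ i) (s i)) (Finset.mem_univ a)]
  simp only [Function.update_self, measure_univ, mul_one]
  congr 1
  refine Finset.prod_congr rfl fun b hb => ?_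
  rw [Function.update_of_ne (Finset.ne_of_mem_erase hb)]


noncomputable abbrev gam (A : Type*) [Fintype A] : Measure (A → ℝ) :=
  Measure.pi fun _ : A => gaussianReal 0 1

lemma int_bdd {A : Type*} [Fintype A] (f : (A → ℝ) → ℝ) (hc : Continuous f) (B : ℝ)
    (hB : ∀ g, |f g| ≤ B) : Integrable f (gam A) :=
  Integrable.of_bound hc.aestronglyMeasurable B (by simpa using Filter.Eventually.of_forall hB)

lemma int_coord {A : Type*} [Fintype A] (a : A) : Integrable (fun g : A → ℝ => g a) (gam A) :=
  integrable_comp_eval (μ := fun _ : A => gaussianReal 0 1) (f := fun r : ℝ => r)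
    ((memLp_id_gaussianReal 1).integrable (by simp))

lemma stein {A : Type*} [Fintype A] [DecidableEq A] (a : A) (f f' : (A → ℝ) → ℝ)
    (hf : ∀ g r, HasDerivAt (fun r => f (Function.update g a r)) (f' (Function.update g a r)) r)
    (hc : Continuous f) (hc' : Continuous f') (B : ℝ)
    (hB : ∀ r, |f r| ≤ B) (hB' : ∀ r, |f' r| ≤ B) :
    Integrable (fun g => g a * f g) (gam A) ∧
    ∫ g, g a * f g ∂(gam A) = ∫ g, f' g ∂(gam A) := by
  have i1 : Integrable (fun g => g a * f g) (gam A) :=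
    (int_coord a).mul_bdd (c := B) hc.aestronglyMeasurable
      (by simpa using Filter.Eventually.of_forall hB)
  have i2 := int_bdd f' hc' B hB'
  have mp := pi_update (fun _ : A => gaussianReal 0 1) a
  have tr : ∀ F : (A → ℝ) → ℝ, Integrable F (gam A) → ∫ g, F g ∂(gam A) =
      ∫ g, ∫ r, F (Function.update g a r) ∂(gaussianReal 0 1) ∂(gam A) := by
    intro F hF
    rw [← integral_prod (fun p : (A → ℝ) × ℝ => F (Function.update p.1 a p.2))
      (mp.integrable_comp_of_integrable hF)]
    have := integral_map (μ := (gam A).prod (gaussianReal 0 1)) (f := F) mp.measurable.aemeasurable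
      (by rw [mp.map_eq]; exact hF.aestronglyMeasurable)
    rw [mp.map_eq] at this
    exact this
  refine ⟨i1, ?_⟩
  rw [tr _ i1, tr _ i2]
  congr 1
  ext g
  simp only [Function.update_self]
  refine stein1 _ _ (hf g) (hc'.comp (by fun_prop)) B (fun r => hB _) (fun r => hB' _)

/-- fields on the Nishimori line -/
def fld {A : Type*} (u g : A → ℝ) : A → ℝ := fun a => u a * g a + u a ^ 2

lemma fld_cont {A : Type*} (u : A → ℝ) : Continuous (fld u) := by
  unfold fld; fun_prop

lemma heat {A : Type*} [Fintype A] [DecidableEq A] (Φ : (A → ℝ) → ℝ) (Φ1 Φ2 : A → (A → ℝ) → ℝ)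
    (hΦ : ∀ (h : ℝ → A → ℝ) (h' : A → ℝ) (t : ℝ), (∀ a, HasDerivAt (fun t => h t a) (h' a) t) →
      HasDerivAt (fun t => Φ (h t)) (∑ a, h' a * Φ1 a (h t)) t)
    (hΦ1 : ∀ a g r, HasDerivAt (fun r => Φ1 a (Function.update g a r))
      (Φ2 a (Function.update g a r)) r)
    (c0 : Continuous Φ) (c1 : ∀ a, Continuous (Φ1 a)) (c2 : ∀ a, Continuous (Φ2 a))
    (B : ℝ) (b1 : ∀ a h, |Φ1 a h| ≤ B) (b2 : ∀ a h, |Φ2 a h| ≤ B)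
    (hint : ∀ u, Integrable (fun g => Φ (fld u g)) (gam A))
    (u u' : ℝ → A → ℝ) (hu : ∀ a t, HasDerivAt (fun t => u t a) (u' t a) t)
    (D : ℝ) (bu : ∀ a t, |u t a| ≤ D) (bu' : ∀ a t, |u' t a| ≤ D) (t : ℝ) :
    HasDerivAt (fun t => ∫ g, Φ (fld (u t) g) ∂(gam A))
      (∑ a, 2 * u t a * u' t a * ∫ g, (Φ2 a (fld (u t) g) / 2 + Φ1 a (fld (u t) g)) ∂(gam A)) t := by
  have hfl : ∀ g s a, HasDerivAt (fun t => fld (u t) g a) (u' s a * g a + 2 * u s a * u' s a) s := by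
    intro g s a
    unfold fld
    convert! ((hu a s).mul_const (g a)).add ((hu a s).pow 2) using 1
    simp
  have main := hasDerivAt_integral_of_dominated_loc_of_deriv_le (μ := gam A) (𝕜 := ℝ)
    (F := fun t g => Φ (fld (u t) g)) (x₀ := t) (s := Set.univ)
    (F' := fun t g => ∑ a, (u' t a * g a + 2 * u t a * u' t a) * Φ1 a (fld (u t) g))
    (bound := fun g => ∑ a, (D * |g a| + 2 * D * D) * B) Filter.univ_mem
    (Filter.Eventually.of_forall fun t => (c0.comp (fld_cont _)).aestronglyMeasurable)
    (hint (u t)) (by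
      refine Continuous.aestronglyMeasurable ?_
      refine continuous_finsetSum _ fun a _ => ?_
      exact Continuous.mul (by fun_prop) ((c1 a).comp (fld_cont _)))
    (by
      refine Filter.Eventually.of_forall fun g s _ => ?_
      refine (norm_sum_le _ _).trans (Finset.sum_le_sum fun a _ => ?_)
      have hD : 0 ≤ D := (abs_nonneg _).trans (bu a s)
      rw [norm_mul]
      refine mul_le_mul ?_ (b1 _ _) (norm_nonneg _) (by positivity)
      refine (norm_add_le _ _).trans (add_le_add ?_ ?_)
      · rw [norm_mul]
        exact mul_le_mul_of_nonneg_right (bu' a s) (norm_nonneg _)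
      · rw [norm_mul, norm_mul]
        have h1 := bu' a s
        have h2 := bu a s
        simp only [Real.norm_eq_abs, Nat.abs_ofNat]
        gcongr)
    (by
      refine integrable_finsetSum _ fun a _ => ?_
      exact (((int_coord a).abs.const_mul D).add (integrable_const _)).mul_const B)
    (Filter.Eventually.of_forall fun g s _ => hΦ (fun t => fld (u t) g) _ s (hfl g s))
  have h2 := main.2
  convert! h2 using 1
  have st : ∀ a, Integrable (fun g => g a * Φ1 a (fld (u t) g)) (gam A) ∧
    ∫ g, g a * Φ1 a (fld (u t) g) ∂(gam A) = ∫ g, u t a * Φ2 a (fld (u t) g) ∂(gam A) := by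
    intro a
    refine stein a (fun g => Φ1 a (fld (u t) g)) (fun g => u t a * Φ2 a (fld (u t) g)) ?_
      ((c1 a).comp (fld_cont _)) (((c2 a).comp (fld_cont _)).const_mul _) (B + D * B) ?_ ?_
    · intro g r
      have e : ∀ r, fld (u t) (Function.update g a r) =
          Function.update (fld (u t) g) a (u t a * r + u t a ^ 2) := by
        intro r
        ext b
        by_cases hb : b = a
        · subst hb; simp [fld]
        · simp [fld, Function.update_of_ne hb]
      simp_rw [e]
      have h3 : HasDerivAt (fun r => u t a * r + u t a ^ 2) (u t a) r := by
        simpa using ((hasDerivAt_id r).const_mul (u t a)).add_const (u t a ^ 2)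
      have := (hΦ1 a (fld (u t) g) (u t a * r + u t a ^ 2)).comp r h3
      rw [mul_comm]
      exact this
    · intro g
      have h1 := b1 a (fld (u t) g)
      have h2 := bu a t
      have : 0 ≤ D * B := mul_nonneg ((abs_nonneg _).trans h2) ((abs_nonneg _).trans h1)
      linarith
    · intro g
      have h1 := b2 a (fld (u t) g)
      have h2 := bu a t
      have h3 := mul_le_mul h2 h1 (abs_nonneg _) ((abs_nonneg _).trans h2)
      rw [abs_mul]
      linarith [(abs_nonneg _).trans h1]
  have j1 : ∀ a, Integrable (fun g => Φ1 a (fld (u t) g)) (gam A) := fun a =>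
    int_bdd _ ((c1 a).comp (fld_cont _)) B fun g => b1 _ _
  have j2 : ∀ a, Integrable (fun g => Φ2 a (fld (u t) g)) (gam A) := fun a =>
    int_bdd _ ((c2 a).comp (fld_cont _)) B fun g => b2 _ _
  have e : ∀ a, ∀ g : A → ℝ, (u' t a * g a + 2 * u t a * u' t a) * Φ1 a (fld (u t) g) =
      u' t a * (g a * Φ1 a (fld (u t) g)) + (2 * u t a * u' t a) * Φ1 a (fld (u t) g) :=
    fun a g => by ring
  simp_rw [e]
  have jj : ∀ a, Integrable (fun g => u' t a * (g a * Φ1 a (fld (u t) g)) +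
      (2 * u t a * u' t a) * Φ1 a (fld (u t) g)) (gam A) := fun a =>
    ((st a).1.const_mul _).add ((j1 a).const_mul _)
  rw [integral_finsetSum _ fun a _ => jj a]
  refine Finset.sum_congr rfl fun a _ => ?_
  rw [integral_add ((st a).1.const_mul _) ((j1 a).const_mul _), integral_const_mul, (st a).2,
    integral_const_mul, integral_const_mul, integral_add ((j2 a).div_const _) (j1 a),
    integral_div]
  ring

lemma planted {A : Type*} [Fintype A] (u e : A → ℝ) (he : ∀ a, e a ^ 2 = 1)
    (Ψ : (A → ℝ) → ℝ) (hc : Continuous Ψ) (B : ℝ) (hB : ∀ h, |Ψ h| ≤ B) :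
    Integrable (fun g => (∏ a, Real.exp (e a * u a * g a - u a ^ 2 / 2)) *
      Ψ (fun a => u a * g a)) (gam A) ∧
    ∫ g, Ψ (fun a => e a * fld u g a) ∂(gam A) =
    ∫ g, (∏ a, Real.exp (e a * u a * g a - u a ^ 2 / 2)) * Ψ (fun a => u a * g a) ∂(gam A) := by
  have mp : MeasurePreserving (fun (g : A → ℝ) a => e a * (g a + u a)) (gam A)
      (Measure.pi fun a => gaussianReal (e a * u a) 1) := by
    refine measurePreserving_pi _ _ (f := fun a r => e a * (r + u a)) fun a => ⟨by fun_prop, ?_⟩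
    have : (fun r => e a * (r + u a)) = (fun r => e a * r) ∘ (fun r => r + u a) := rfl
    rw [this, ← Measure.map_map (by fun_prop) (by fun_prop), gaussianReal_map_add_const,
      gaussianReal_map_const_mul]
    congr 1
    · ring
    · ext; simp [he a]
  have hd := pi_dens (fun a x => ENNReal.ofReal (Real.exp (e a * u a * x - (e a * u a) ^ 2 / 2)))
    (fun a => by fun_prop) (fun _ : A => gaussianReal 0 1) (fun a => gaussianReal (e a * u a) 1)
    (fun a => gauss_shift _)
  have hc2 : Continuous (fun g : A → ℝ => Ψ (fun a => u a * g a)) := hc.comp (by fun_prop)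
  have hm : Measurable fun x : A → ℝ =>
      ∏ a, ENNReal.ofReal (Real.exp (e a * u a * x a - (e a * u a) ^ 2 / 2)) := by fun_prop
  have hlt : ∀ x : A → ℝ,
      ∏ a, ENNReal.ofReal (Real.exp (e a * u a * x a - (e a * u a) ^ 2 / 2)) < ⊤ :=
    fun x => ENNReal.prod_lt_top fun a _ => ENNReal.ofReal_lt_top
  have hr : ∀ x : A → ℝ,
      (∏ a, ENNReal.ofReal (Real.exp (e a * u a * x a - (e a * u a) ^ 2 / 2))).toReal =
      ∏ a, Real.exp (e a * u a * x a - u a ^ 2 / 2) := by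
    intro x
    rw [ENNReal.toReal_prod]
    refine Finset.prod_congr rfl fun a _ => ?_
    rw [ENNReal.toReal_ofReal (Real.exp_pos _).le, mul_pow, he a, one_mul]
  constructor
  · have : Integrable (fun g : A → ℝ => Ψ (fun a => u a * g a))
        (Measure.pi fun a => gaussianReal (e a * u a) 1) :=
      Integrable.of_bound hc2.aestronglyMeasurable B
        (Filter.Eventually.of_forall fun g => hB _)
    rw [hd, integrable_withDensity_iff_integrable_smul' hm (Filter.Eventually.of_forall hlt)] at this
    simpa only [hr, smul_eq_mul] using this
  · have h1 : ∫ g, Ψ (fun a => e a * fld u g a) ∂(gam A) =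
        ∫ g, Ψ (fun a => u a * g a) ∂(Measure.pi fun a => gaussianReal (e a * u a) 1) := by
      rw [← mp.map_eq, integral_map mp.measurable.aemeasurable hc2.aestronglyMeasurable]
      congr 1; ext g; congr 1; ext a; simp only [fld]; ring
    rw [h1, hd, integral_withDensity_eq_integral_toReal_smul hm (Filter.Eventually.of_forall hlt)]
    simp only [hr, smul_eq_mul]

section gibbs
set_option linter.unusedSectionVars false
variable {S A : Type*} [Fintype S] [Nonempty S] [Fintype A] [DecidableEq A] (s : A → S → ℝ)

noncomputable def wt (h : A → ℝ) (σ : S) : ℝ := Real.exp (∑ a, h a * s a σ)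
noncomputable def Zf (h : A → ℝ) : ℝ := ∑ σ, wt s h σ
noncomputable def Gb (f : S → ℝ) (h : A → ℝ) : ℝ := (∑ σ, f σ * wt s h σ) / Zf s h

lemma wt_pos (h : A → ℝ) (σ : S) : 0 < wt s h σ := Real.exp_pos _

lemma Zf_pos (h : A → ℝ) : 0 < Zf s h :=
  Finset.sum_pos (fun σ _ => wt_pos s h σ) Finset.univ_nonempty

lemma Zf_cont : Continuous (Zf s) := by unfold Zf wt; fun_prop

lemma Gb_cont (f : S → ℝ) : Continuous (Gb s f) := by
  unfold Gb
  refine Continuous.div ?_ (Zf_cont s) fun h => (Zf_pos s h).ne'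
  unfold wt; fun_prop

lemma Gb_abs (f : S → ℝ) (hf : ∀ σ, |f σ| ≤ 1) (h : A → ℝ) : |Gb s f h| ≤ 1 := by
  unfold Gb
  rw [abs_div, abs_of_pos (Zf_pos s h), div_le_one (Zf_pos s h)]
  refine (Finset.abs_sum_le_sum_abs _ _).trans (Finset.sum_le_sum fun σ _ => ?_)
  rw [abs_mul, abs_of_pos (wt_pos s h σ)]
  exact mul_le_of_le_one_left (wt_pos s h σ).le (hf σ)

lemma wt_deriv (h : ℝ → A → ℝ) (h' : A → ℝ) (t : ℝ)
    (hh : ∀ a, HasDerivAt (fun t => h t a) (h' a) t) (σ : S) :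
    HasDerivAt (fun t => wt s (h t) σ) (wt s (h t) σ * ∑ a, h' a * s a σ) t := by
  unfold wt
  exact (HasDerivAt.fun_sum fun a _ => (hh a).mul_const (s a σ)).exp

lemma num_deriv (f : S → ℝ) (h : ℝ → A → ℝ) (h' : A → ℝ) (t : ℝ)
    (hh : ∀ a, HasDerivAt (fun t => h t a) (h' a) t) :
    HasDerivAt (fun t => ∑ σ, f σ * wt s (h t) σ)
      (∑ a, h' a * (Gb s (fun σ => f σ * s a σ) (h t) * Zf s (h t))) t := by
  have := HasDerivAt.fun_sum (u := Finset.univ) fun σ _ => (wt_deriv s h h' t hh σ).const_mul (f σ)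
  convert! this using 1
  have hz := (Zf_pos s (h t)).ne'
  simp only [Gb, div_mul_cancel₀ _ hz, Finset.mul_sum]
  rw [Finset.sum_comm]
  refine Finset.sum_congr rfl fun σ _ => Finset.sum_congr rfl fun a _ => ?_
  ring

lemma Z_deriv (h : ℝ → A → ℝ) (h' : A → ℝ) (t : ℝ)
    (hh : ∀ a, HasDerivAt (fun t => h t a) (h' a) t) :
    HasDerivAt (fun t => Zf s (h t))
      (∑ a, h' a * (Gb s (s a) (h t) * Zf s (h t))) t := by
  have := num_deriv s (fun _ => 1) h h' t hh
  simpa [Zf] using this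

lemma logZ_deriv (h : ℝ → A → ℝ) (h' : A → ℝ) (t : ℝ)
    (hh : ∀ a, HasDerivAt (fun t => h t a) (h' a) t) :
    HasDerivAt (fun t => Real.log (Zf s (h t)))
      (∑ a, h' a * Gb s (s a) (h t)) t := by
  have hz := (Zf_pos s (h t)).ne'
  have := (Z_deriv s h h' t hh).log hz
  convert! this using 1
  rw [Finset.sum_div]
  refine Finset.sum_congr rfl fun a _ => ?_
  field_simp

lemma Gb_deriv (f : S → ℝ) (h : ℝ → A → ℝ) (h' : A → ℝ) (t : ℝ)
    (hh : ∀ a, HasDerivAt (fun t => h t a) (h' a) t) :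
    HasDerivAt (fun t => Gb s f (h t))
      (∑ a, h' a * (Gb s (fun σ => f σ * s a σ) (h t) - Gb s f (h t) * Gb s (s a) (h t))) t := by
  have hz := (Zf_pos s (h t)).ne'
  have := (num_deriv s f h h' t hh).div (Z_deriv s h h' t hh) hz
  convert! this using 1
  have e : ∑ σ, f σ * wt s (h t) σ = Gb s f (h t) * Zf s (h t) := by
    rw [Gb, div_mul_cancel₀ _ hz]
  rw [e, Finset.sum_mul, Finset.mul_sum, ← Finset.sum_sub_distrib, Finset.sum_div]
  refine Finset.sum_congr rfl fun a _ => ?_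
  field_simp

lemma Gb_deriv_update (f : S → ℝ) (a : A) (g : A → ℝ) (r : ℝ) :
    HasDerivAt (fun r => Gb s f (Function.update g a r))
      (Gb s (fun σ => f σ * s a σ) (Function.update g a r) -
        Gb s f (Function.update g a r) * Gb s (s a) (Function.update g a r)) r := by
  have := Gb_deriv s f (fun r => Function.update g a r) (Pi.single a 1) r (fun b => by
    by_cases hb : b = a
    · subst hb; simpa using hasDerivAt_id' r
    · simpa [Function.update_of_ne hb, Pi.single_eq_of_ne hb] using hasDerivAt_const r (g b))
  simpa [Pi.single_apply] using this

lemma logZ_int (hs : ∀ a σ, s a σ ^ 2 = 1) (u : A → ℝ) :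
    Integrable (fun g => Real.log (Zf s (fld u g))) (gam A) := by
  have hs1 : ∀ a σ, |s a σ| = 1 := fun a σ => by
    rw [← sq_eq_sq₀ (abs_nonneg _) zero_le_one, sq_abs, hs]; norm_num
  have hb : ∀ h : A → ℝ, |Real.log (Zf s h)| ≤ Real.log (Fintype.card S) + ∑ a, |h a| := by
    intro h
    have h1 : ∀ σ, |∑ a, h a * s a σ| ≤ ∑ a, |h a| := fun σ => by
      refine (Finset.abs_sum_le_sum_abs _ _).trans (Finset.sum_le_sum fun a _ => ?_)
      rw [abs_mul, hs1, mul_one]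
    have hc : (1 : ℝ) ≤ Fintype.card S := by exact_mod_cast Fintype.card_pos
    have hl := Real.log_nonneg hc
    rw [abs_le]
    constructor
    · rw [Real.le_log_iff_exp_le (Zf_pos s h)]
      obtain ⟨σ⟩ := ‹Nonempty S›
      refine le_trans ?_ (Finset.single_le_sum (fun σ _ => (wt_pos s h σ).le) (Finset.mem_univ σ))
      refine Real.exp_le_exp.2 ?_
      have := (abs_le.1 (h1 σ)).1
      linarith
    · rw [Real.log_le_iff_le_exp (Zf_pos s h), Real.exp_add, Real.exp_log (by linarith)]
      have : Zf s h ≤ ∑ σ : S, Real.exp (∑ a, |h a|) :=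
        Finset.sum_le_sum fun σ _ => Real.exp_le_exp.2 (abs_le.1 (h1 σ)).2
      simpa using this
  refine Integrable.mono' (g := fun g => Real.log (Fintype.card S) + ∑ a, |fld u g a|) ?_ ?_ ?_
  · refine (integrable_const _).add (integrable_finsetSum _ fun a _ => ?_)
    unfold fld
    exact (((int_coord a).const_mul _).add (integrable_const _)).abs
  · exact (((Zf_cont s).comp (fld_cont u)).log fun g => (Zf_pos s _).ne').aestronglyMeasurable
  · exact Filter.Eventually.of_forall fun g => hb _

variable (mul : S → S ≃ S)

lemma sum_gauge (hsm : ∀ a τ σ, s a (mul τ σ) = s a τ * s a σ)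
    (f : S → ℝ) (hf2 : ∀ σ, f σ ^ 2 = 1) (hfm : ∀ τ σ, f (mul τ σ) = f τ * f σ) (τ : S)
    (h : A → ℝ) :
    ∑ σ, f σ * wt s (fun a => s a τ * h a) σ = f τ * ∑ σ, f σ * wt s h σ := by
  rw [← Equiv.sum_comp (mul τ) (fun σ => f σ * wt s h σ), Finset.mul_sum]
  refine Finset.sum_congr rfl fun σ _ => ?_
  rw [hfm]
  have : wt s (fun a => s a τ * h a) σ = wt s h (mul τ σ) := by
    unfold wt; congr 1
    refine Finset.sum_congr rfl fun a _ => ?_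
    rw [hsm]; ring
  rw [this]
  linear_combination (-(f σ * wt s h (mul τ σ))) * hf2 τ

lemma Gb_gauge (hsm : ∀ a τ σ, s a (mul τ σ) = s a τ * s a σ)
    (f : S → ℝ) (hf2 : ∀ σ, f σ ^ 2 = 1) (hfm : ∀ τ σ, f (mul τ σ) = f τ * f σ) (τ : S)
    (h : A → ℝ) : Gb s f (fun a => s a τ * h a) = f τ * Gb s f h := by
  have h1 := sum_gauge s mul hsm f hf2 hfm τ h
  have h2 := sum_gauge s mul hsm (fun _ => 1) (by simp) (by simp) τ h
  simp only [one_mul] at h2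
  unfold Gb Zf
  rw [h1, h2, mul_div_assoc]

lemma nish (hs : ∀ a σ, s a σ ^ 2 = 1) (hsm : ∀ a τ σ, s a (mul τ σ) = s a τ * s a σ)
    (f : S → ℝ) (hf2 : ∀ σ, f σ ^ 2 = 1) (hfm : ∀ τ σ, f (mul τ σ) = f τ * f σ)
    (Ψ : (A → ℝ) → ℝ) (hc : Continuous Ψ) (B : ℝ) (hB : ∀ h, |Ψ h| ≤ B)
    (hΨ : ∀ τ h, Ψ (fun a => s a τ * h a) = f τ * Ψ h) (u : A → ℝ) :
    ∫ g, Ψ (fld u g) ∂(gam A) = ∫ g, Gb s f (fld u g) * Ψ (fld u g) ∂(gam A) := by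
  have hf1 : ∀ σ, |f σ| ≤ 1 := fun σ => by
    rw [← sq_le_sq₀ (abs_nonneg _) zero_le_one, sq_abs, hf2]; norm_num
  have hBB : ∀ h, |Gb s f h * Ψ h| ≤ B := fun h => by
    rw [abs_mul]
    have := mul_le_mul (Gb_abs s f hf1 h) (hB h) (abs_nonneg _) zero_le_one
    linarith
  have p1 := fun τ => planted u (fun a => s a τ) (fun a => hs a τ) Ψ hc B hB
  have p2 := fun τ => planted u (fun a => s a τ) (fun a => hs a τ) (fun h => Gb s f h * Ψ h)
    ((Gb_cont s f).mul hc) B hBB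
  have q1 : (Fintype.card S : ℝ) * ∫ g, Ψ (fld u g) ∂(gam A) = ∑ τ : S, f τ *
      ∫ g, Ψ (fun a => s a τ * fld u g a) ∂(gam A) := by
    rw [← nsmul_eq_mul, ← Finset.card_univ, ← Finset.sum_const]
    refine Finset.sum_congr rfl fun τ _ => ?_
    simp_rw [hΨ]
    rw [integral_const_mul, ← mul_assoc, ← sq, hf2, one_mul]
  have q2 : (Fintype.card S : ℝ) * ∫ g, Gb s f (fld u g) * Ψ (fld u g) ∂(gam A) = ∑ τ : S,
      ∫ g, Gb s f (fun a => s a τ * fld u g a) * Ψ (fun a => s a τ * fld u g a) ∂(gam A) := by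
    rw [← nsmul_eq_mul, ← Finset.card_univ, ← Finset.sum_const]
    refine Finset.sum_congr rfl fun τ _ => ?_
    simp_rw [hΨ, Gb_gauge s mul hsm f hf2 hfm]
    congr 1; ext g
    linear_combination (-(Gb s f (fld u g) * Ψ (fld u g))) * hf2 τ
  have hcard : (Fintype.card S : ℝ) ≠ 0 := by exact_mod_cast Fintype.card_ne_zero
  refine mul_left_cancel₀ hcard ?_
  rw [q1, q2]
  simp_rw [fun τ => (p1 τ).2, fun τ => (p2 τ).2]
  simp_rw [← integral_const_mul]
  rw [← integral_finsetSum _ fun τ _ => (p1 τ).1.const_mul _,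
    ← integral_finsetSum _ fun τ _ => (p2 τ).1]
  congr 1; ext g
  have hρ : ∀ τ, ∏ a, Real.exp (s a τ * u a * g a - u a ^ 2 / 2) =
      Real.exp (-∑ a, u a ^ 2 / 2) * wt s (fun a => u a * g a) τ := by
    intro τ
    rw [← Real.exp_sum, wt, ← Real.exp_add, ← Finset.sum_neg_distrib, ← Finset.sum_add_distrib]
    congr 1
    refine Finset.sum_congr rfl fun a _ => ?_
    ring
  simp_rw [hρ]
  have e : ∑ σ, f σ * wt s (fun a => u a * g a) σ =
      Gb s f (fun a => u a * g a) * Zf s (fun a => u a * g a) := by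
    rw [Gb, div_mul_cancel₀ _ (Zf_pos s _).ne']
  calc _ = Real.exp (-∑ a, u a ^ 2 / 2) * (∑ σ, f σ * wt s (fun a => u a * g a) σ) *
        Ψ (fun a => u a * g a) := by
        rw [Finset.mul_sum, Finset.sum_mul]
        refine Finset.sum_congr rfl fun a _ => ?_
        ring
    _ = _ := by
        rw [e, Zf]
        rw [Finset.mul_sum, Finset.mul_sum, Finset.sum_mul]
        refine Finset.sum_congr rfl fun a _ => ?_
        ring
end gibbs

section convex
variable {S A : Type*} [Fintype S] [Nonempty S] [Fintype A] [DecidableEq A] (s : A → S → ℝ)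

noncomputable def Cv (f k : S → ℝ) (h : A → ℝ) : ℝ :=
  Gb s (fun σ => f σ * k σ) h - Gb s f h * Gb s k h

lemma Cv_psd (d : A → ℝ) (h : A → ℝ) : 0 ≤ ∑ b, ∑ a, d b * d a * Cv s (s b) (s a) h ^ 2 := by
  have hz := (Zf_pos s h).ne'
  set w : S → ℝ := fun σ => wt s h σ / Zf s h with hw
  have hw0 : ∀ σ, 0 ≤ w σ := fun σ => div_nonneg (wt_pos s h σ).le (Zf_pos s h).le
  have hw1 : ∑ σ, w σ = 1 := by
    rw [hw, ← Finset.sum_div]; exact div_self hz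
  have hG : ∀ f, Gb s f h = ∑ σ, w σ * f σ := fun f => by
    rw [Gb, Finset.sum_div]
    refine Finset.sum_congr rfl fun σ _ => ?_
    simp only [hw]; ring
  have hC : ∀ b a, Cv s (s b) (s a) h =
      ∑ σ, w σ * ((s b σ - Gb s (s b) h) * (s a σ - Gb s (s a) h)) := by
    intro b a
    have : ∀ σ, w σ * ((s b σ - Gb s (s b) h) * (s a σ - Gb s (s a) h)) =
        w σ * (s b σ * s a σ) - Gb s (s a) h * (w σ * s b σ) - Gb s (s b) h * (w σ * s a σ)
          + Gb s (s b) h * Gb s (s a) h * w σ := fun σ => by ring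
    simp_rw [this]
    rw [Finset.sum_add_distrib, Finset.sum_sub_distrib, Finset.sum_sub_distrib, ← Finset.mul_sum,
      ← Finset.mul_sum, ← Finset.mul_sum, hw1, ← hG, ← hG, ← hG, Cv]
    ring
  have key : ∑ b, ∑ a, d b * d a * Cv s (s b) (s a) h ^ 2 =
      ∑ σ, ∑ τ, w σ * w τ *
        (∑ b, d b * ((s b σ - Gb s (s b) h) * (s b τ - Gb s (s b) h))) ^ 2 := by
    have l : ∀ b a, d b * d a * Cv s (s b) (s a) h ^ 2 = ∑ σ, ∑ τ, w σ * w τ *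
        ((d b * ((s b σ - Gb s (s b) h) * (s b τ - Gb s (s b) h))) *
        (d a * ((s a σ - Gb s (s a) h) * (s a τ - Gb s (s a) h)))) := by
      intro b a
      rw [hC, sq, Finset.sum_mul_sum, Finset.mul_sum]
      refine Finset.sum_congr rfl fun σ _ => ?_
      rw [Finset.mul_sum]
      refine Finset.sum_congr rfl fun τ _ => ?_
      ring
    simp_rw [l, sq, Finset.sum_mul_sum, Finset.mul_sum]
    rw [Finset.sum_congr rfl fun b _ => Finset.sum_comm, Finset.sum_comm]
    refine Finset.sum_congr rfl fun σ _ => ?_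
    rw [Finset.sum_congr rfl fun b _ => Finset.sum_comm, Finset.sum_comm]
  rw [key]
  exact Finset.sum_nonneg fun σ _ => Finset.sum_nonneg fun τ _ =>
    mul_nonneg (mul_nonneg (hw0 σ) (hw0 τ)) (sq_nonneg _)

variable (mul : S → S ≃ S)

theorem convex_bound (hs : ∀ a σ, s a σ ^ 2 = 1)
    (hsm : ∀ a τ σ, s a (mul τ σ) = s a τ * s a σ) (v : A → ℝ) (p : A → Prop) [DecidablePred p] :
    (∫ g, Real.log (Zf s (fld (fun a => if p a then 0 else v a) g)) ∂(gam A)) +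
      ∑ a, (if p a then v a ^ 2 else -v a ^ 2) *
        ((1 + ∫ g, Gb s (s a) (fld (fun a => if p a then 0 else v a) g) ∂(gam A)) / 2)
    ≤ ∫ g, Real.log (Zf s (fld (fun a => if p a then v a else 0) g)) ∂(gam A) := by
  have hs1 : ∀ a σ, |s a σ| ≤ 1 := fun a σ => by
    rw [← sq_le_sq₀ (abs_nonneg _) zero_le_one, sq_abs, hs]; norm_num
  have hss1 : ∀ a b σ, |s a σ * s b σ| ≤ 1 := fun a b σ => by
    rw [abs_mul]; exact mul_le_one₀ (hs1 a σ) (abs_nonneg _) (hs1 b σ)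
  have Gone : ∀ h, Gb s (fun _ => 1) h = 1 := fun h => by
    simp only [Gb, one_mul]; exact div_self (Zf_pos s h).ne'
  have hsa : ∀ a, (fun σ => s a σ * s a σ) = fun _ => 1 := fun a => by
    ext σ; rw [← sq, hs]
  have hsba : ∀ b a, (fun σ => s b σ * s a σ * s a σ) = s b := fun b a => by
    ext σ; rw [mul_assoc, ← sq, hs, mul_one]
  have G1 : ∀ a h, |Gb s (s a) h| ≤ 1 := fun a h => Gb_abs s _ (hs1 a) h
  have GG1 : ∀ a b h, |Gb s (s a) h * Gb s (s b) h| ≤ 1 := fun a b h => by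
    rw [abs_mul]; exact mul_le_one₀ (G1 a h) (abs_nonneg _) (G1 b h)
  have C2 : ∀ b a h, |Cv s (s b) (s a) h| ≤ 2 := fun b a h => by
    have h1 := Gb_abs s _ (hss1 b a) h
    have h2 := GG1 b a h
    unfold Cv
    rw [abs_le] at *
    constructor <;> linarith
  have Cc : ∀ b a, Continuous (Cv s (s b) (s a)) := fun b a =>
    (Gb_cont s _).sub ((Gb_cont s _).mul (Gb_cont s _))
  set d : A → ℝ := fun a => if p a then v a ^ 2 else -v a ^ 2 with hd
  set u : ℝ → A → ℝ := fun t a => if p a then v a * Real.sin t else v a * Real.cos t with hu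
  set u' : ℝ → A → ℝ := fun t a => if p a then v a * Real.cos t else -(v a * Real.sin t) with hu'
  have huu : ∀ a t, HasDerivAt (fun t => u t a) (u' t a) t := by
    intro a t
    simp only [hu, hu']
    split_ifs
    · exact (Real.hasDerivAt_sin t).const_mul _
    · simpa using (Real.hasDerivAt_cos t).const_mul (v a)
  have hud : ∀ t a, 2 * u t a * u' t a = d a * Real.sin (2 * t) := by
    intro t a
    simp only [hu, hu', hd, Real.sin_two_mul]
    split_ifs <;> ring
  have hvD : ∀ a, |v a| ≤ ∑ a, |v a| := fun a =>
    Finset.single_le_sum (f := fun a => |v a|) (fun _ _ => abs_nonneg _) (Finset.mem_univ a)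
  have bs : ∀ a t, |v a * Real.sin t| ≤ ∑ a, |v a| := fun a t => by
    rw [abs_mul]
    exact (mul_le_of_le_one_right (abs_nonneg _) (Real.abs_sin_le_one t)).trans (hvD a)
  have bc : ∀ a t, |v a * Real.cos t| ≤ ∑ a, |v a| := fun a t => by
    rw [abs_mul]
    exact (mul_le_of_le_one_right (abs_nonneg _) (Real.abs_cos_le_one t)).trans (hvD a)
  have bu : ∀ a t, |u t a| ≤ ∑ a, |v a| := fun a t => by
    simp only [hu]; split_ifs
    exacts [bs a t, bc a t]
  have bu' : ∀ a t, |u' t a| ≤ ∑ a, |v a| := fun a t => by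
    simp only [hu']; split_ifs
    · exact bc a t
    · rw [abs_neg]; exact bs a t
  have iG : ∀ a v, Integrable (fun g => Gb s (s a) (fld v g)) (gam A) := fun a v =>
    int_bdd _ ((Gb_cont s _).comp (fld_cont _)) 1 fun g => G1 _ _
  -- first derivative
  have F1 : ∀ t, HasDerivAt (fun t => ∫ g, Real.log (Zf s (fld (u t) g)) ∂(gam A))
      (Real.sin (2 * t) * ∑ a, d a * ((1 + ∫ g, Gb s (s a) (fld (u t) g) ∂(gam A)) / 2)) t := by
    intro t
    have := heat (fun h => Real.log (Zf s h)) (fun a => Gb s (s a))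
      (fun a h => 1 - Gb s (s a) h ^ 2) (logZ_deriv s)
      (fun a g r => by
        have := Gb_deriv_update s (s a) a g r
        rw [hsa, Gone, ← sq] at this
        exact this)
      ((Zf_cont s).log fun g => (Zf_pos s _).ne') (fun a => Gb_cont s _)
      (fun a => continuous_const.sub ((Gb_cont s _).pow 2)) 1 G1
      (fun a h => by
        have := abs_le.1 (G1 a h)
        rw [abs_le]
        constructor <;> nlinarith) (logZ_int s hs) u u' huu _ bu bu' t
    convert! this using 1
    rw [Finset.mul_sum]
    refine Finset.sum_congr rfl fun a _ => ?_
    rw [hud]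
    have i2 : Integrable (fun g => Gb s (s a) (fld (u t) g) * Gb s (s a) (fld (u t) g)) (gam A) :=
      int_bdd _ (((Gb_cont s _).comp (fld_cont _)).mul ((Gb_cont s _).comp (fld_cont _))) 1
        fun g => GG1 _ _ _
    have n := nish s mul hs hsm (s a) (hs a) (hsm a) (Gb s (s a)) (Gb_cont s _) 1 (G1 a)
      (Gb_gauge s mul hsm (s a) (hs a) (hsm a)) (u t)
    have e : ∀ g, (1 - Gb s (s a) (fld (u t) g) ^ 2) / 2 + Gb s (s a) (fld (u t) g) =
      1 / 2 + (Gb s (s a) (fld (u t) g) -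
        (1 / 2) * (Gb s (s a) (fld (u t) g) * Gb s (s a) (fld (u t) g))) := fun g => by ring
    simp_rw [e]
    have i3 : Integrable (fun g => Gb s (s a) (fld (u t) g) -
        (1 / 2) * (Gb s (s a) (fld (u t) g) * Gb s (s a) (fld (u t) g))) (gam A) :=
      (iG a _).sub (i2.const_mul _)
    rw [integral_add (integrable_const _) i3, integral_sub (iG a _) (i2.const_mul _), integral_const_mul, ← n]
    simp
    ring
  -- second derivative
  have F2 : ∀ t b, HasDerivAt (fun t => ∫ g, Gb s (s b) (fld (u t) g) ∂(gam A))
      (Real.sin (2 * t) * ∑ a, d a * ∫ g, Cv s (s b) (s a) (fld (u t) g) ^ 2 ∂(gam A)) t := by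
    intro t b
    have := heat (Gb s (s b)) (fun a => Cv s (s b) (s a))
      (fun a h => -2 * (Cv s (s b) (s a) h * Gb s (s a) h)) (Gb_deriv s (s b))
      (fun a g r => by
        have h1 := Gb_deriv_update s (fun σ => s b σ * s a σ) a g r
        have h2 := Gb_deriv_update s (s b) a g r
        have h3 := Gb_deriv_update s (s a) a g r
        rw [hsa, Gone] at h3
        rw [hsba] at h1
        convert! h1.sub (h2.mul h3) using 1
        unfold Cv
        ring)
      (Gb_cont s _) (fun a => Cc b a)
      (fun a => continuous_const.mul ((Cc b a).mul (Gb_cont s _))) 4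
      (fun a h => (C2 b a h).trans (by norm_num))
      (fun a h => by
        have := mul_le_mul (C2 b a h) (G1 a h) (abs_nonneg _) (by norm_num)
        rw [abs_mul, abs_mul]
        norm_num
        linarith) (iG b) u u' huu _ bu bu' t
    convert! this using 1
    rw [Finset.mul_sum]
    refine Finset.sum_congr rfl fun a _ => ?_
    rw [hud]
    have hba2 : ∀ σ, (s b σ * s a σ) ^ 2 = 1 := fun σ => by rw [mul_pow, hs, hs, one_mul]
    have hbam : ∀ τ σ, s b (mul τ σ) * s a (mul τ σ) = (s b τ * s a τ) * (s b σ * s a σ) :=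
      fun τ σ => by rw [hsm, hsm]; ring
    have Cg : ∀ τ h, Cv s (s b) (s a) (fun c => s c τ * h c) =
        (s b τ * s a τ) * Cv s (s b) (s a) h := by
      intro τ h
      unfold Cv
      rw [Gb_gauge s mul hsm _ (hs b) (hsm b), Gb_gauge s mul hsm _ (hs a) (hsm a),
        Gb_gauge s mul hsm (fun σ => s b σ * s a σ) hba2 hbam]
      ring
    have bCG : ∀ h, |Cv s (s b) (s a) h * Gb s (s a) h| ≤ 2 := fun h => by
      have := mul_le_mul (C2 b a h) (G1 a h) (abs_nonneg _) (by norm_num)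
      rw [abs_mul]; linarith
    have n1 := nish s mul hs hsm (fun σ => s b σ * s a σ) hba2 hbam (Cv s (s b) (s a)) (Cc b a)
      2 (C2 b a) Cg (u t)
    have n2 := nish s mul hs hsm (s b) (hs b) (hsm b) (fun h => Cv s (s b) (s a) h * Gb s (s a) h)
      ((Cc b a).mul (Gb_cont s _)) 2 bCG (fun τ h => by
        rw [Cg, Gb_gauge s mul hsm _ (hs a) (hsm a)]
        linear_combination (s b τ * Cv s (s b) (s a) h * Gb s (s a) h) * hs a τ) (u t)
    have fc := fld_cont (u t)
    have i1 : Integrable (fun g => Cv s (s b) (s a) (fld (u t) g)) (gam A) :=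
      int_bdd _ ((Cc b a).comp fc) 2 fun g => C2 _ _ _
    have i2 : Integrable (fun g => Cv s (s b) (s a) (fld (u t) g) * Gb s (s a) (fld (u t) g))
        (gam A) := int_bdd _ (((Cc b a).comp fc).mul ((Gb_cont s _).comp fc)) 2 fun g => bCG _
    have i3 : Integrable (fun g => Gb s (fun σ => s b σ * s a σ) (fld (u t) g) *
        Cv s (s b) (s a) (fld (u t) g)) (gam A) :=
      i1.bdd_mul (c := 1) ((Gb_cont s _).comp fc).aestronglyMeasurable
        (Filter.Eventually.of_forall fun g => Gb_abs s _ (hss1 b a) _)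
    have i4 : Integrable (fun g => Gb s (s b) (fld (u t) g) *
        (Cv s (s b) (s a) (fld (u t) g) * Gb s (s a) (fld (u t) g))) (gam A) :=
      i2.bdd_mul (c := 1) ((Gb_cont s _).comp fc).aestronglyMeasurable
        (Filter.Eventually.of_forall fun g => G1 b _)
    have e1 : ∀ g, Cv s (s b) (s a) (fld (u t) g) ^ 2 =
        Gb s (fun σ => s b σ * s a σ) (fld (u t) g) * Cv s (s b) (s a) (fld (u t) g) -
        Gb s (s b) (fld (u t) g) *
          (Cv s (s b) (s a) (fld (u t) g) * Gb s (s a) (fld (u t) g)) := fun g => by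
      unfold Cv; ring
    have e2 : ∀ g, -2 * (Cv s (s b) (s a) (fld (u t) g) * Gb s (s a) (fld (u t) g)) / 2 +
        Cv s (s b) (s a) (fld (u t) g) = Cv s (s b) (s a) (fld (u t) g) -
          Cv s (s b) (s a) (fld (u t) g) * Gb s (s a) (fld (u t) g) := fun g => by ring
    simp_rw [e1, e2]
    rw [integral_sub i3 i4, integral_sub i1 i2, ← n1, ← n2]
    ring
  set Dn : ℝ → ℝ := fun t => ∑ a, d a * ((1 + ∫ g, Gb s (s a) (fld (u t) g) ∂(gam A)) / 2) with hDn
  have D1 : ∀ t, HasDerivAt Dn (Real.sin (2 * t) / 2 *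
      ∫ g, ∑ b, ∑ a, d b * d a * Cv s (s b) (s a) (fld (u t) g) ^ 2 ∂(gam A)) t := by
    intro t
    have := HasDerivAt.fun_sum (u := Finset.univ) fun a _ =>
      (((F2 t a).const_add 1).div_const 2).const_mul (d a)
    convert! this using 1
    have ii : ∀ b a, Integrable (fun g => d b * d a * Cv s (s b) (s a) (fld (u t) g) ^ 2) (gam A) := by
      intro b a
      refine Integrable.const_mul (int_bdd _ (((Cc b a).comp (fld_cont _)).pow 2) 4 fun g => ?_) _
      have := abs_le.1 (C2 b a (fld (u t) g))
      change |Cv s (s b) (s a) (fld (u t) g) ^ 2| ≤ 4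
      rw [abs_le]
      constructor <;> nlinarith
    rw [integral_finsetSum _ fun b _ => integrable_finsetSum _ fun a _ => ii b a, Finset.mul_sum]
    refine Finset.sum_congr rfl fun b _ => ?_
    rw [integral_finsetSum _ fun a _ => ii b a]
    simp_rw [integral_const_mul, Finset.mul_sum]
    rw [Finset.sum_div, Finset.mul_sum]
    refine Finset.sum_congr rfl fun a _ => ?_
    ring
  have hpi := Real.pi_pos
  have sn : ∀ t ∈ interior (Set.Icc 0 (Real.pi / 2)), 0 ≤ Real.sin (2 * t) := by
    intro t ht
    rw [interior_Icc] at ht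
    exact Real.sin_nonneg_of_nonneg_of_le_pi (by linarith [ht.1]) (by linarith [ht.2])
  have Dmono : MonotoneOn Dn (Set.Icc 0 (Real.pi / 2)) := by
    refine monotoneOn_of_deriv_nonneg (convex_Icc _ _)
      (fun t _ => (D1 t).continuousAt.continuousWithinAt)
      (fun t _ => (D1 t).differentiableAt.differentiableWithinAt) fun t ht => ?_
    rw [(D1 t).deriv]
    exact mul_nonneg (div_nonneg (sn t ht) (by norm_num)) (integral_nonneg fun g => Cv_psd s d _)
  have K1 : ∀ t, HasDerivAt (fun t => (∫ g, Real.log (Zf s (fld (u t) g)) ∂(gam A)) -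
      Real.sin t ^ 2 * Dn 0) (Real.sin (2 * t) * (Dn t - Dn 0)) t := by
    intro t
    convert! (F1 t).sub (((Real.hasDerivAt_sin t).pow 2).mul_const (Dn 0)) using 1
    simp only [Real.sin_two_mul]
    push_cast
    ring
  have Kmono := monotoneOn_of_deriv_nonneg (convex_Icc 0 (Real.pi / 2))
      (fun t _ => (K1 t).continuousAt.continuousWithinAt)
      (fun t _ => (K1 t).differentiableAt.differentiableWithinAt) (fun t ht => by
        rw [(K1 t).deriv]
        refine mul_nonneg (sn t ht) (sub_nonneg.2 ?_)
        exact Dmono ⟨le_rfl, by positivity⟩ (interior_subset ht) (interior_subset ht).1)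
  have fin := Kmono (a := 0) ⟨le_rfl, by positivity⟩ (b := Real.pi / 2) ⟨by positivity, le_rfl⟩
    (by positivity)
  have u0 : u 0 = fun a => if p a then 0 else v a := by simp [hu]
  have u1 : u (Real.pi / 2) = fun a => if p a then v a else 0 := by simp [hu]
  simp only [Real.sin_zero, Real.sin_pi_div_two, u1] at fin
  rw [← u0]
  simp only [hDn] at fin
  linarith
end convex

section rf
variable {N : ℕ}

lemma spin_sq (σ : Fin N → Bool) (i : Fin N) : spin σ i ^ 2 = 1 := by
  unfold spin; split_ifs <;> norm_num

/-- gauge transformation -/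
def gmul (τ : Fin N → Bool) : (Fin N → Bool) ≃ (Fin N → Bool) :=
  Function.Involutive.toPerm (fun σ i => σ i == τ i) (fun σ => by
    ext i; simp)

lemma spin_gmul (τ σ : Fin N → Bool) (i : Fin N) :
    spin (gmul τ σ) i = spin τ i * spin σ i := by
  have : gmul τ σ i = (σ i == τ i) := rfl
  unfold spin
  rw [this]
  cases σ i <;> cases τ i <;> simp

/-- off-diagonal: pair interaction; diagonal: field -/
noncomputable def obs (p : Fin N × Fin N) (σ : Fin N → Bool) : ℝ :=
  if p.1 ≠ p.2 then spin σ p.1 * spin σ p.2 else spin σ p.1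

lemma obs_sq (p : Fin N × Fin N) (σ : Fin N → Bool) : obs p σ ^ 2 = 1 := by
  unfold obs; split_ifs <;> simp [mul_pow, spin_sq]

lemma obs_gmul (p : Fin N × Fin N) (τ σ : Fin N → Bool) :
    obs p (gmul τ σ) = obs p τ * obs p σ := by
  unfold obs; split_ifs <;> simp only [spin_gmul]
  ring

lemma sum_factor (y : Fin N → ℝ) (T : Finset (Fin N)) :
    ∑ σ : Fin N → Bool, (∏ k ∈ T, spin σ k) * Real.exp (∑ k, y k * spin σ k) =
      ∏ k, (if k ∈ T then 2 * Real.sinh (y k) else 2 * Real.cosh (y k)) := by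
  have h1 : ∀ k, (if k ∈ T then 2 * Real.sinh (y k) else 2 * Real.cosh (y k)) =
      ∑ b : Bool, (if k ∈ T then (if b then (1:ℝ) else -1) else 1) *
        Real.exp (y k * (if b then (1:ℝ) else -1)) := by
    intro k
    rw [Real.sinh_eq, Real.cosh_eq]
    split_ifs <;> simp <;> ring
  simp_rw [h1]
  rw [Finset.prod_univ_sum, Fintype.piFinset_univ]
  refine Finset.sum_congr rfl fun σ _ => ?_
  rw [Finset.prod_mul_distrib, Real.exp_sum, Finset.prod_ite_mem, Finset.univ_inter]
  rfl

lemma wt_rf (h : Fin N × Fin N → ℝ) (hh : ∀ p, p.1 ≠ p.2 → h p = 0) (σ : Fin N → Bool) :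
    wt obs h σ = Real.exp (∑ k, h (k, k) * spin σ k) := by
  unfold wt
  congr 1
  rw [Fintype.sum_prod_type]
  refine Finset.sum_congr rfl fun i _ => ?_
  rw [Finset.sum_eq_single i]
  · simp [obs]
  · intro j _ hj
    rw [hh (i, j) (Ne.symm hj), zero_mul]
  · simp

lemma Zf_rf (h : Fin N × Fin N → ℝ) (hh : ∀ p, p.1 ≠ p.2 → h p = 0) :
    Zf obs h = ∏ k, 2 * Real.cosh (h (k, k)) := by
  unfold Zf
  simp_rw [wt_rf h hh]
  simpa using sum_factor (fun k => h (k, k)) ∅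

lemma Gb_rf (h : Fin N × Fin N → ℝ) (hh : ∀ p, p.1 ≠ p.2 → h p = 0) (T : Finset (Fin N)) :
    Gb obs (fun σ => ∏ k ∈ T, spin σ k) h = ∏ k ∈ T, Real.tanh (h (k, k)) := by
  unfold Gb
  rw [Zf_rf h hh]
  simp_rw [wt_rf h hh]
  rw [sum_factor (fun k => h (k, k)) T, ← Finset.prod_div_distrib]
  rw [← Finset.univ_inter T, ← Finset.prod_ite_mem]
  refine Finset.prod_congr rfl fun k _ => ?_
  have := Real.cosh_pos (h (k, k))
  simp only [Finset.univ_inter]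
  split_ifs
  · rw [Real.tanh_eq_sinh_div_cosh]; field_simp
  · field_simp

lemma tanh_abs (x : ℝ) : |Real.tanh x| ≤ 1 := (Real.abs_tanh_lt_one x).le

lemma tanh_cont : Continuous Real.tanh := by
  have : Real.tanh = fun x => Real.sinh x / Real.cosh x := by
    ext x; exact Real.tanh_eq_sinh_div_cosh x
  rw [this]
  exact Real.continuous_sinh.div Real.continuous_cosh fun x => (Real.cosh_pos x).ne'

lemma logcosh_int (b c : ℝ) :
    Integrable (fun y => Real.log (2 * Real.cosh (b * y + c))) (gaussianReal 0 1) := by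
  have hid : Integrable (fun r : ℝ => r) (gaussianReal 0 1) :=
    (memLp_id_gaussianReal 1).integrable (by simp)
  refine Integrable.mono' (g := fun y => Real.log 2 + |b * y + c|)
    ((integrable_const _).add ((hid.const_mul b).add (integrable_const c)).abs) ?_ ?_
  · refine Continuous.aestronglyMeasurable (Continuous.log (by fun_prop) fun y => ?_)
    have := Real.cosh_pos (b * y + c)
    positivity
  · refine Filter.Eventually.of_forall fun y => ?_
    have h1 := Real.one_le_cosh (b * y + c)
    have h0 : 0 ≤ Real.log (2 * Real.cosh (b * y + c)) := Real.log_nonneg (by linarith)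
    rw [Real.norm_eq_abs, abs_of_nonneg h0, Real.log_le_iff_le_exp (by linarith), Real.exp_add,
      Real.exp_log (by norm_num)]
    have h2 : Real.cosh (b * y + c) ≤ Real.exp |b * y + c| := by
      rw [Real.cosh_eq]
      have h3 := Real.exp_le_exp.2 (le_abs_self (b * y + c))
      have h4 := Real.exp_le_exp.2 (neg_le_abs (b * y + c))
      linarith
    linarith

theorem nishimori_bound_aux (β q : ℝ) (hq : 0 ≤ q)
    (x : Fin N × Fin N → ℝ) (hx : ∀ p, 0 ≤ x p) :
    (N : ℝ) * (∫ y, Real.log (2 * Real.cosh (β * Real.sqrt q * y + β ^ 2 * q))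
          ∂(gaussianReal 0 1))
      + (1 / 2) * (∑ p ∈ Finset.univ.filter (fun p : Fin N × Fin N => p.1 ≠ p.2),
          x p * (1 + (∫ y, Real.tanh (β * Real.sqrt q * y + β ^ 2 * q)
                    ∂(gaussianReal 0 1)) ^ 2))
      - ((N : ℝ) * β ^ 2 * q / 2) *
          (1 + ∫ y, Real.tanh (β * Real.sqrt q * y + β ^ 2 * q) ∂(gaussianReal 0 1))
    ≤ ∫ J : Fin N × Fin N → ℝ,
        Real.log (∑ σ : Fin N → Bool, Real.exp
          (∑ p ∈ Finset.univ.filter (fun p : Fin N × Fin N => p.1 ≠ p.2),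
            (Real.sqrt (x p) * J p + x p) * spin σ p.1 * spin σ p.2)) ∂(gam (Fin N × Fin N)) := by
  set M := ∫ y, Real.tanh (β * Real.sqrt q * y + β ^ 2 * q) ∂(gaussianReal 0 1) with hM
  set v : Fin N × Fin N → ℝ := fun p => if p.1 ≠ p.2 then Real.sqrt (x p) else β * Real.sqrt q
    with hv
  have hb : (β * Real.sqrt q) ^ 2 = β ^ 2 * q := by rw [mul_pow, Real.sq_sqrt hq]
  have main := convex_bound (obs (N := N)) gmul obs_sq obs_gmul v (fun p => p.1 ≠ p.2)
  set w : Fin N × Fin N → ℝ := fun a => if a.1 ≠ a.2 then 0 else v a with hw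
  have hdiag : ∀ g k, fld w g (k, k) = β * Real.sqrt q * g (k, k) + β ^ 2 * q := by
    intro g k; simp [fld, hw, hv, hb]
  have hoff : ∀ g p, p.1 ≠ p.2 → fld w g p = 0 := by
    intro g p hp; simp [fld, hw, hp]
  have tc : Continuous fun y => Real.tanh (β * Real.sqrt q * y + β ^ 2 * q) :=
    tanh_cont.comp (by fun_prop)
  have e0 : ∫ g, Real.log (Zf obs (fld w g)) ∂(gam (Fin N × Fin N)) =
      N * ∫ y, Real.log (2 * Real.cosh (β * Real.sqrt q * y + β ^ 2 * q)) ∂(gaussianReal 0 1) := by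
    have h1 : ∀ g, Real.log (Zf obs (fld w g)) =
        ∑ k, Real.log (2 * Real.cosh (β * Real.sqrt q * g (k, k) + β ^ 2 * q)) := by
      intro g
      rw [Zf_rf _ (hoff g), Real.log_prod fun k _ => by
        have := Real.cosh_pos (fld w g (k, k)); positivity]
      simp_rw [hdiag]
    simp_rw [h1]
    have hi := logcosh_int (β * Real.sqrt q) (β ^ 2 * q)
    have h2 : ∀ k : Fin N, ∫ g, Real.log (2 * Real.cosh (β * Real.sqrt q * g (k, k) + β ^ 2 * q))
        ∂(gam (Fin N × Fin N)) =
        ∫ y, Real.log (2 * Real.cosh (β * Real.sqrt q * y + β ^ 2 * q)) ∂(gaussianReal 0 1) :=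
      fun k => integral_comp_eval (μ := fun _ : Fin N × Fin N => gaussianReal 0 1)
        (i := (k, k)) hi.aestronglyMeasurable
    rw [integral_finsetSum _ fun k _ =>
      integrable_comp_eval (μ := fun _ : Fin N × Fin N => gaussianReal 0 1) (i := (k, k)) hi]
    simp_rw [h2]
    simp
  have t1 : ∀ k : Fin N, ∫ g, Real.tanh (β * Real.sqrt q * g (k, k) + β ^ 2 * q)
      ∂(gam (Fin N × Fin N)) = M := fun k =>
    integral_comp_eval (μ := fun _ : Fin N × Fin N => gaussianReal 0 1)
        (i := (k, k)) tc.aestronglyMeasurable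
  have e1 : ∀ k, ∫ g, Gb obs (obs (k, k)) (fld w g) ∂(gam (Fin N × Fin N)) = M := by
    intro k
    rw [← t1 k]
    congr 1; ext g
    have := Gb_rf (fld w g) (hoff g) {k}
    simp only [Finset.prod_singleton, hdiag] at this
    rw [← this]
    congr 1; ext σ; simp [obs]
  have e2 : ∀ p : Fin N × Fin N, p.1 ≠ p.2 →
      ∫ g, Gb obs (obs p) (fld w g) ∂(gam (Fin N × Fin N)) = M ^ 2 := by
    rintro ⟨i, j⟩ hij
    have h1 : ∀ g, Gb obs (obs (i, j)) (fld w g) =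
        Real.tanh (β * Real.sqrt q * g (i, i) + β ^ 2 * q) *
        Real.tanh (β * Real.sqrt q * g (j, j) + β ^ 2 * q) := by
      intro g
      have := Gb_rf (fld w g) (hoff g) {i, j}
      simp only [Finset.prod_pair hij, hdiag] at this
      rw [← this]
      congr 1; ext σ; simp only [obs, if_pos hij]
    simp_rw [h1]
    have ind := (iIndepFun_pi (μ := fun _ : Fin N × Fin N => gaussianReal 0 1)
      (X := fun _ y => Real.tanh (β * Real.sqrt q * y + β ^ 2 * q))
      (fun _ => tc.measurable.aemeasurable)).indepFun (i := (i, i)) (j := (j, j))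
      (by intro h; exact hij (Prod.ext_iff.1 h).1)
    have := ind.integral_fun_mul_eq_mul_integral
      (tc.comp (continuous_apply _)).aestronglyMeasurable
      (tc.comp (continuous_apply _)).aestronglyMeasurable
    rw [this, t1, t1, sq]
  have e3 : ∑ a : Fin N × Fin N, (if a.1 ≠ a.2 then v a ^ 2 else -v a ^ 2) *
        ((1 + ∫ g, Gb obs (obs a) (fld w g) ∂(gam (Fin N × Fin N))) / 2) =
      (1 / 2) * (∑ p ∈ Finset.univ.filter (fun p : Fin N × Fin N => p.1 ≠ p.2),
          x p * (1 + M ^ 2)) - ((N : ℝ) * β ^ 2 * q / 2) * (1 + M) := by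
    have h1 : ∀ a : Fin N × Fin N, (if a.1 ≠ a.2 then v a ^ 2 else -v a ^ 2) *
        ((1 + ∫ g, Gb obs (obs a) (fld w g) ∂(gam (Fin N × Fin N))) / 2) =
        (if a.1 ≠ a.2 then (1 / 2) * (x a * (1 + M ^ 2)) else 0) -
          (if a.1 = a.2 then β ^ 2 * q / 2 * (1 + M) else 0) := by
      rintro ⟨i, j⟩
      by_cases hij : i = j
      · subst hij
        rw [e1]
        simp [hv, hb]
        ring
      · rw [e2 _ hij]
        simp [hv, hij, Real.sq_sqrt (hx (i, j))]
        ring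
    simp_rw [h1]
    rw [Finset.sum_sub_distrib, ← Finset.sum_filter, ← Finset.mul_sum]
    congr 1
    rw [Fintype.sum_prod_type]
    simp
    ring
  have e4 : ∀ g : Fin N × Fin N → ℝ, Zf obs (fld (fun a => if a.1 ≠ a.2 then v a else 0) g) =
      ∑ σ : Fin N → Bool, Real.exp
          (∑ p ∈ Finset.univ.filter (fun p : Fin N × Fin N => p.1 ≠ p.2),
            (Real.sqrt (x p) * g p + x p) * spin σ p.1 * spin σ p.2) := by
    intro g
    unfold Zf wt
    refine Finset.sum_congr rfl fun σ _ => ?_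
    congr 1
    rw [Finset.sum_filter]
    refine Finset.sum_congr rfl fun p _ => ?_
    by_cases hp : p.1 = p.2
    · simp [fld, hp]
    · simp [fld, hp, hv, obs, Real.sq_sqrt (hx p)]
      ring
  rw [e0, e3] at main
  simp_rw [e4] at main
  linarith

end rf

/-- Gibbs–Bogoliubov lower bound on the Nishimori line via the random-field
trial system. For the Kac spin glass on the Nishimori line (exponent
`Σ_{i≠j} (√(x^γ_{ij}) J_{ij} + x^γ_{ij}) σ_i σ_j` with `J_{ij}` i.i.d. `N(0,1)` and
`x^γ_{ij} = β² K(r_ij,γ)/2 ≥ 0`), and any `q ≥ 0`, with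
`M = ∫ Dy tanh(β√q y + β²q)`:
`E[log Z^γ_L] ≥ L^d ∫ Dy log 2cosh(β√q y + β²q)
  + (1/2) Σ_{i≠j} x^γ_{ij} (1 + M²) - (L^d β² q/2)(1 + M)`. -/
theorem gibbs_bogoliubov_nishimori_bound (L d : ℕ) (hL : 0 < L) (hd : 0 < d)
    (β q : ℝ) (hβ : 0 < β) (hq : 0 ≤ q)
    (Kv : Fin (L ^ d) → Fin (L ^ d) → ℝ) (hK : ∀ i j, 0 ≤ Kv i j) :
    (L : ℝ) ^ d * (∫ y, Real.log (2 * Real.cosh (β * Real.sqrt q * y + β ^ 2 * q))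
          ∂(gaussianReal 0 1))
      + (1 / 2) * (∑ p ∈ Finset.univ.filter
            (fun p : Fin (L ^ d) × Fin (L ^ d) => p.1 ≠ p.2),
          (β ^ 2 * Kv p.1 p.2 / 2) *
            (1 + (∫ y, Real.tanh (β * Real.sqrt q * y + β ^ 2 * q)
                    ∂(gaussianReal 0 1)) ^ 2))
      - ((L : ℝ) ^ d * β ^ 2 * q / 2) *
          (1 + ∫ y, Real.tanh (β * Real.sqrt q * y + β ^ 2 * q) ∂(gaussianReal 0 1))
    ≤ ∫ J : Fin (L ^ d) × Fin (L ^ d) → ℝ,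
        Real.log (∑ σ : Fin (L ^ d) → Bool, Real.exp
          (∑ p ∈ Finset.univ.filter
              (fun p : Fin (L ^ d) × Fin (L ^ d) => p.1 ≠ p.2),
            (Real.sqrt (β ^ 2 * Kv p.1 p.2 / 2) * J p + β ^ 2 * Kv p.1 p.2 / 2)
              * spin σ p.1 * spin σ p.2))
        ∂(Measure.pi fun _ : Fin (L ^ d) × Fin (L ^ d) => gaussianReal 0 1) := by
  have := nishimori_bound_aux (N := L ^ d) β q hq (fun p => β ^ 2 * Kv p.1 p.2 / 2)
    (fun p => by have := hK p.1 p.2; positivity)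
  push_cast at this
  exact this
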